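/- arXiv:1211.0910 — 2 statements merged into one kernel-verified Lean document; each statement's English description precedes it below -/
import Mathlib

section
/- The minimum number of vertices of a simple graph whose set of vertex degrees is exactly {4, 5} and whose girth is 5 equals 21; that is, there exists a graph with degree set {4,5}, girth 5 and 21 vertices, and every graph with degree set {4,5} and girth 5 has at least 21 vertices. -/
open SimpleGraph

/-- Degree of a vertex, as the cardinality of its neighbour set. -/
noncomputable def ndeg {V : Type} (G : SimpleGraph V) (v : V) : ℕ :=
  (G.neighborSet v).ncard

/-- The degree set of a graph: the set of degrees of its vertices. -/
def degreeSet' {V : Type} (G : SimpleGraph V) : Set ℕ :=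
  {d | ∃ v, ndeg G v = d}

/-- The set of orders of finite graphs with degree set exactly `D` and girth `5`. -/
def cageOrders (D : Set ℕ) : Set ℕ :=
  {n | ∃ (V : Type) (G : SimpleGraph V), Finite V ∧ Nat.card V = n ∧
        G.egirth = 5 ∧ degreeSet' G = D}

/-- A graph has girth at least five iff it has no triangle and no two distinct vertices have two
common neighbours. -/
theorem five_le_egirth_iff {V : Type} (G : SimpleGraph V) :
    5 ≤ G.egirth ↔ (∀ u v w, G.Adj u v → G.Adj v w → ¬ G.Adj w u) ∧
      ∀ u v a b, u ≠ v → G.Adj u a → G.Adj a v → G.Adj u b → G.Adj b v → a = b := by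
  constructor
  · intro h
    rw [le_egirth] at h
    constructor
    · intro u v w huv hvw hwu
      have hc : (Walk.cons huv (Walk.cons hvw (Walk.cons hwu Walk.nil))).IsCycle := by
        have := huv.ne
        have := hvw.ne
        have := hwu.ne
        simp [Walk.cons_isCycle_iff]
        grind
      have := h _ _ hc
      norm_num at this
    · intro u v a b huv hua hav hub hbv
      by_contra hab
      have hc : (Walk.cons hua (Walk.cons hav (Walk.cons hbv.symm
          (Walk.cons hub.symm Walk.nil)))).IsCycle := by
        have := hua.ne
        have := hav.ne
        have := hub.ne
        have := hbv.ne
        simp [Walk.cons_isCycle_iff]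
        grind
      have := h _ _ hc
      norm_num at this
  · rintro ⟨h3, h4⟩
    rw [le_egirth]
    intro a w hw
    have hlen := hw.three_le_length
    by_contra! hlt
    have hlt' : w.length < 5 := by exact_mod_cast hlt
    cases w with
    | nil => simp at hlen
    | cons hab p =>
    cases p with
    | nil => simp at hlen
    | cons hbc p =>
    cases p with
    | nil => simp at hlen
    | cons hcd p =>
    cases p with
    | nil => exact h3 _ _ _ hab hbc hcd
    | cons hda p =>
    cases p with
    | nil =>
      have hn := hw.support_nodup
      simp at hn
      have := h4 _ _ _ _ (by grind) hab hbc hda.symm hcd.symm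
      grind
    | cons _ p => simp at hlt'; omega

/-- A finite graph of girth at least five with a vertex of degree `d` and minimum degree at least
`k + 1` has at least `1 + d + d * k` vertices. -/
theorem card_ge_of_five_le_egirth {V : Type} [Finite V] {G : SimpleGraph V} {k : ℕ}
    (hg : 5 ≤ G.egirth) (hmin : ∀ w, k + 1 ≤ ndeg G w) (v : V) :
    1 + ndeg G v + ndeg G v * k ≤ Nat.card V := by
  classical
  have := Fintype.ofFinite V
  obtain ⟨h3, h4⟩ := (five_le_egirth_iff G).1 hg
  have hdeg : ∀ w, ndeg G w = (G.neighborFinset w).card := fun w =>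
    Set.ncard_eq_toFinset_card' _
  set S := (G.neighborFinset v).biUnion fun w => (G.neighborFinset w).erase v with hS
  have hScard : ndeg G v * k ≤ S.card := by
    rw [hS, Finset.card_biUnion, hdeg v, ← smul_eq_mul]
    · refine Finset.card_nsmul_le_sum _ _ _ fun w hw => ?_
      have hv : v ∈ G.neighborFinset w := by
        simpa [G.adj_comm] using hw
      have := hmin w
      rw [hdeg] at this
      rw [Finset.card_erase_of_mem hv]
      omega
    · intro a ha b hb hab
      refine Finset.disjoint_left.2 fun x hxa hxb => ?_
      simp only [Finset.mem_erase, mem_neighborFinset, Finset.mem_coe] at *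
      exact hab (h4 v x a b (Ne.symm hxa.1) ha hxa.2 hb hxb.2)
  have hdisj : Disjoint (insert v (G.neighborFinset v)) S := by
    rw [Finset.disjoint_left]
    intro x hx hxS
    simp only [hS, Finset.mem_biUnion, Finset.mem_erase, Finset.mem_insert,
      mem_neighborFinset] at hx hxS
    obtain ⟨w, hvw, hxv, hwx⟩ := hxS
    exact hx.elim hxv fun h => h3 v w x hvw hwx h.symm
  have hle := Finset.card_le_univ (insert v (G.neighborFinset v) ∪ S)
  rw [Finset.card_union_of_disjoint hdisj, Finset.card_insert_of_notMem (by simp), ← hdeg] at hle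
  rw [Nat.card_eq_fintype_card]
  omega

/-- The neighbourhoods of a graph on 21 vertices with degrees 4 and 5 and girth 5. -/
def cageNeighbors : Fin 21 → Finset (Fin 21) :=
  ![{1, 2, 3, 4, 5}, {0, 6, 7, 8}, {0, 9, 10, 11}, {0, 12, 13, 14},
    {0, 15, 16, 17}, {0, 18, 19, 20}, {1, 10, 14, 15, 19}, {1, 11, 17, 18},
    {1, 9, 12, 16}, {2, 8, 14, 18}, {2, 6, 13, 20}, {2, 7, 12, 19},
    {3, 8, 11, 15, 20}, {3, 10, 16, 18}, {3, 6, 9, 17}, {4, 6, 12, 18},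
    {4, 8, 13, 19}, {4, 7, 14, 20}, {5, 7, 9, 13, 15}, {5, 6, 11, 16},
    {5, 10, 12, 17}]

theorem cageNeighbors_symm : ∀ u, ∀ v ∈ cageNeighbors u, u ∈ cageNeighbors v := by
  decide +kernel

/-- A graph on 21 vertices with degrees 4 and 5 and girth 5. -/
def cageGraph : SimpleGraph (Fin 21) where
  Adj u v := v ∈ cageNeighbors u
  symm := ⟨fun u v h => cageNeighbors_symm u v h⟩
  loopless := ⟨by decide +kernel⟩

theorem ndeg_cageGraph (u : Fin 21) : ndeg cageGraph u = (cageNeighbors u).card :=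
  Set.ncard_coe_finset (cageNeighbors u)

theorem egirth_cageGraph : cageGraph.egirth = 5 := by
  apply le_antisymm
  · have h01 : cageGraph.Adj 0 1 := by unfold cageGraph; decide +kernel
    have h16 : cageGraph.Adj 1 6 := by unfold cageGraph; decide +kernel
    have h6_10 : cageGraph.Adj 6 10 := by unfold cageGraph; decide +kernel
    have h10_2 : cageGraph.Adj 10 2 := by unfold cageGraph; decide +kernel
    have h20 : cageGraph.Adj 2 0 := by unfold cageGraph; decide +kernel
    have hc : (Walk.cons h01 (Walk.cons h16 (Walk.cons h6_10 (Walk.cons h10_2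
        (Walk.cons h20 Walk.nil))))).IsCycle := by
      simp [Walk.cons_isCycle_iff]
    exact (egirth_le_length hc).trans (by simp)
  · rw [five_le_egirth_iff]
    constructor
    · have h : ∀ u, ∀ v ∈ cageNeighbors u, ∀ w ∈ cageNeighbors v, u ∉ cageNeighbors w := by
        decide +kernel
      exact fun u v w huv hvw => h u v huv w hvw
    · have h : ∀ u, ∀ a ∈ cageNeighbors u, ∀ v ∈ cageNeighbors a, u ≠ v →
          ∀ b ∈ cageNeighbors u, v ∈ cageNeighbors b → a = b := by
        decide +kernel
      exact fun u v a b huv hua hav hub hbv => h u a hua v hav huv b hub hbv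

theorem degreeSet'_cageGraph : degreeSet' cageGraph = {4, 5} := by
  have h : ∀ u, (cageNeighbors u).card = 4 ∨ (cageNeighbors u).card = 5 := by decide +kernel
  ext d
  simp only [degreeSet', ndeg_cageGraph, Set.mem_ofPred_eq, Set.mem_insert_iff,
    Set.mem_singleton_iff]
  constructor
  · rintro ⟨u, rfl⟩
    exact h u
  · rintro (rfl | rfl)
    · exact ⟨1, by decide +kernel⟩
    · exact ⟨0, by decide +kernel⟩

/-- the minimum order of a graph with degree set exactly {4,5} and girth 5
equals 21. -/
theorem stmt7 : IsLeast (cageOrders {4, 5}) 21 := by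
  refine ⟨⟨Fin 21, cageGraph, inferInstance, by simp, egirth_cageGraph,
    degreeSet'_cageGraph⟩, ?_⟩
  rintro n ⟨V, G, hfin, rfl, hg, hD⟩
  obtain ⟨v, hv⟩ : 5 ∈ degreeSet' G := by simp [hD]
  have hmin : ∀ w, 3 + 1 ≤ ndeg G w := fun w => by
    have hw : ndeg G w ∈ degreeSet' G := ⟨w, rfl⟩
    rw [hD] at hw
    rcases hw with hw | hw <;> rw [hw]
    norm_num
  have := card_ge_of_five_le_egirth hg.ge hmin v
  rw [hv] at this
  omega
end

section
/- For every prime q with q ≡ 1 (mod 4) and q ≥ 13, setting r = q+1, the minimum number of vertices of a simple graph whose set of vertex degrees is exactly {r, 2r−5} and whose girth is 5 equals r(2r−5) + 1 = 2q^2 − q − 2; that is, there exists such a graph with r(2r−5)+1 vertices, and every graph with degree set {r, 2r−5} and girth 5 has at least r(2r−5)+1 vertices. -/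
open SimpleGraph

/-- Every cycle has length at least five as soon as there are no triangles and no two distinct
vertices have two distinct common neighbours. -/
theorem five_le_egirth {V : Type} {G : SimpleGraph V}
    (h3 : ∀ a b c, G.Adj a b → G.Adj b c → ¬ G.Adj c a)
    (h4 : ∀ a b c d, G.Adj a b → G.Adj b c → G.Adj c d → G.Adj d a → a = c ∨ b = d) :
    5 ≤ G.egirth := by
  rw [SimpleGraph.le_egirth]
  intro a w hw
  have hlen := hw.three_le_length
  by_contra hlt
  have hlt : w.length < 5 := by
    by_contra h
    exact hlt (by exact_mod_cast not_lt.mp h)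
  match w, hw, hlen, hlt with
  | .cons hab (.cons hbc (.cons hca .nil)), _, _, _ => exact h3 _ _ _ hab hbc hca
  | .cons hab (.cons hbc (.cons hcd (.cons hda .nil))), hw, _, _ =>
    have hnd := hw.support_nodup
    simp only [Walk.support_cons, Walk.support_nil, List.tail_cons, List.nodup_cons,
      List.mem_cons, not_or] at hnd
    rcases h4 _ _ _ _ hab hbc hcd hda with h | h
    · exact hnd.2.1.2.1 h.symm
    · exact hnd.1.2.1 h

theorem not_adj_of_five_le_egirth {V : Type} {G : SimpleGraph V} (h : 5 ≤ G.egirth) {a b c : V}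
    (hab : G.Adj a b) (hbc : G.Adj b c) : ¬ G.Adj c a := by
  intro hca
  rw [SimpleGraph.le_egirth] at h
  have hw : (Walk.cons hab (.cons hbc (.cons hca .nil))).IsCycle := by
    simp [Walk.cons_isCycle_iff, hab.ne, hbc.ne, hca.ne, hab.ne', hca.ne']
  have := h _ _ hw
  simp only [Walk.length_cons, Walk.length_nil] at this
  norm_cast at this

theorem eq_or_eq_of_five_le_egirth {V : Type} {G : SimpleGraph V} (h : 5 ≤ G.egirth)
    {a b c d : V} (hab : G.Adj a b) (hbc : G.Adj b c) (hcd : G.Adj c d) (hda : G.Adj d a) :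
    a = c ∨ b = d := by
  by_contra! hne
  rw [SimpleGraph.le_egirth] at h
  have hw : (Walk.cons hab (.cons hbc (.cons hcd (.cons hda .nil)))).IsCycle := by
    simp [Walk.cons_isCycle_iff, hab.ne, hbc.ne, hcd.ne, hda.ne, hab.ne', hda.ne',
      hne.1, hne.2, hne.1.symm]
  have := h _ _ hw
  simp only [Walk.length_cons, Walk.length_nil] at this
  norm_cast at this

/-- The Moore-type bound: if all degrees are at least `r` and there are no cycles of length less
than five, then a vertex `v` forces at least `1 + r * deg v` vertices. -/
theorem mul_ndeg_add_one_le_card {V : Type} [Finite V] {G : SimpleGraph V} (hG : 5 ≤ G.egirth)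
    {r : ℕ} (hr : ∀ u, r ≤ ndeg G u) (v : V) : r * ndeg G v + 1 ≤ Nat.card V := by
  classical
  have := Fintype.ofFinite V
  have hdeg : ∀ u, ndeg G u = (G.neighborFinset u).card := fun u => by
    rw [ndeg, Set.ncard_eq_toFinset_card', SimpleGraph.neighborFinset]
  let S : V → Finset V := fun u => insert u ((G.neighborFinset u).erase v)
  have hcard : ∀ u ∈ G.neighborFinset v, r ≤ (S u).card := by
    intro u hu
    have hu' : G.Adj u v := by simpa using ((G.mem_neighborFinset v u).1 hu).symm
    rw [Finset.card_insert_of_notMem (by simp),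
      Finset.card_erase_add_one (by simpa using hu'), ← hdeg]
    exact hr u
  have hdisj : Set.PairwiseDisjoint (G.neighborFinset v : Set V) S := by
    intro a ha b hb hab
    have ha : G.Adj v a := by simpa using ha
    have hb : G.Adj v b := by simpa using hb
    have hnab : ¬ G.Adj a b := fun h => not_adj_of_five_le_egirth hG ha h hb.symm
    refine Finset.disjoint_left.2 fun z hza hzb => ?_
    simp only [S, Finset.mem_insert, Finset.mem_erase, mem_neighborFinset] at hza hzb
    rcases hza with rfl | ⟨hzv, hza⟩ <;> rcases hzb with rfl | ⟨-, hzb⟩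
    · exact hab rfl
    · exact hnab hzb.symm
    · exact hnab hza
    · rcases eq_or_eq_of_five_le_egirth hG ha hza hzb.symm hb.symm with h | h
      · exact hzv h.symm
      · exact hab h
  have hv : v ∉ (G.neighborFinset v).biUnion S := by
    simp only [S, Finset.mem_biUnion, Finset.mem_insert, Finset.mem_erase, mem_neighborFinset]
    rintro ⟨u, hu, rfl | ⟨h, -⟩⟩
    · exact hu.ne rfl
    · exact h rfl
  calc r * ndeg G v + 1 = ∑ _u ∈ G.neighborFinset v, r + 1 := by
        rw [Finset.sum_const, smul_eq_mul, hdeg, mul_comm]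
    _ ≤ ∑ u ∈ G.neighborFinset v, (S u).card + 1 := by gcongr with u hu; exact hcard u hu
    _ = (insert v ((G.neighborFinset v).biUnion S)).card := by
        rw [Finset.card_insert_of_notMem hv, Finset.card_biUnion hdisj]
    _ ≤ Nat.card V := by rw [Nat.card_eq_fintype_card]; exact Finset.card_le_univ _

theorem ncard_add_card_of_compl {F : Type} [Fintype F] {S : Set F} (T : Finset F)
    (h : ∀ a, a ∈ S ↔ a ∉ T) : S.ncard + T.card = Fintype.card F := by
  classical
  rw [show S = ((Tᶜ : Finset F) : Set F) by ext; simp [h], Set.ncard_coe_finset,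
    Finset.card_compl_add_card]

namespace Biaffine

variable {F : Type} [Field F]

/-- Extra edges between the points of the column with abscissa `x`: the differences `±1` when
`x ≠ 0`, and a star centred at the origin when `x = 0`. -/
def ColumnRel (x y y' : F) : Prop :=
  (x ≠ 0 ∧ (y' = y + 1 ∨ y = y' + 1)) ∨ (x = 0 ∧ (y = 0 ∧ y' ≠ 0 ∨ y' = 0 ∧ y ≠ 0))

/-- Extra edges between parallel lines with intercepts `b` and `b'`: a star centred at `1`, with
the edge from `0` to the leaf `3` added. -/
def InterceptRel (b b' : F) : Prop :=
  (b = 1 ∧ b' ≠ 0 ∧ b' ≠ 1) ∨ (b' = 1 ∧ b ≠ 0 ∧ b ≠ 1) ∨ (b = 0 ∧ b' = 3) ∨ (b' = 0 ∧ b = 3)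

/-- The points `(x, y)` and the lines `Y = m X + b` of slope `m` and intercept `b`
that are kept. -/
def Kept : F × F ⊕ F × F → Prop
  | .inl p => p.1 = 0 → p.2 ≠ 2 ∧ p.2 ≠ 3
  | .inr l => l.2 ≠ 2

/-- Incidence of points and lines, together with the extra edges. -/
def Rel : F × F ⊕ F × F → F × F ⊕ F × F → Prop
  | .inl p, .inl p' => p.1 = p'.1 ∧ ColumnRel p.1 p.2 p'.2
  | .inl p, .inr l => p.2 = l.1 * p.1 + l.2
  | .inr l, .inl p => p.2 = l.1 * p.1 + l.2
  | .inr l, .inr l' => l.1 = l'.1 ∧ InterceptRel l.2 l'.2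

theorem rel_symm (s t : F × F ⊕ F × F) (h : Rel s t) : Rel t s := by
  rcases s with ⟨x, y⟩ | ⟨m, b⟩ <;> rcases t with ⟨x', y'⟩ | ⟨m', b'⟩ <;>
    simp only [Rel, ColumnRel, InterceptRel] at h ⊢ <;> grind

theorem not_rel_self (h3 : (3 : F) ≠ 0) (s : F × F ⊕ F × F) : ¬ Rel s s := by
  rcases s with ⟨x, y⟩ | ⟨m, b⟩ <;> simp only [Rel, ColumnRel, InterceptRel] <;> grind

/-- The amalgam of the biaffine plane over `F` with the extra edges. -/
def graph (h3 : (3 : F) ≠ 0) : SimpleGraph {s : F × F ⊕ F × F // Kept s} where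
  Adj s t := Rel s.1 t.1
  symm := ⟨fun s t h => rel_symm s.1 t.1 h⟩
  loopless := ⟨fun s => not_rel_self h3 s.1⟩

theorem columnRel_symm {x y y' : F} (h : ColumnRel x y y') : ColumnRel x y' y := by
  simp only [ColumnRel] at *
  grind

theorem interceptRel_symm {b b' : F} (h : InterceptRel b b') : InterceptRel b' b := by
  simp only [InterceptRel] at *
  grind

theorem columnRel_no_triangle (h3 : (3 : F) ≠ 0) {x a b c : F}
    (hab : ColumnRel x a b) (hbc : ColumnRel x b c) : ¬ ColumnRel x c a := by
  simp only [ColumnRel] at *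
  grind

theorem columnRel_no_square (h2 : (2 : F) ≠ 0) {x a b c d : F}
    (hab : ColumnRel x a b) (hbc : ColumnRel x b c) (hcd : ColumnRel x c d)
    (hda : ColumnRel x d a) : a = c ∨ b = d := by
  have h4 : (4 : F) ≠ 0 := by
    rw [show (4 : F) = 2 * 2 by norm_num]
    exact mul_ne_zero h2 h2
  simp only [ColumnRel] at *
  grind

theorem interceptRel_no_triangle (h3 : (3 : F) ≠ 0) {a b c : F}
    (hab : InterceptRel a b) (hbc : InterceptRel b c) : ¬ InterceptRel c a := by
  simp only [InterceptRel] at *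
  grind

theorem interceptRel_no_square (h3 : (3 : F) ≠ 0) {a b c d : F}
    (hab : InterceptRel a b) (hbc : InterceptRel b c) (hcd : InterceptRel c d)
    (hda : InterceptRel d a) : a = c ∨ b = d := by
  simp only [InterceptRel] at *
  grind

theorem rel_no_triangle (h3 : (3 : F) ≠ 0) {s t u : F × F ⊕ F × F}
    (hst : Rel s t) (htu : Rel t u) : ¬ Rel u s := by
  intro hus
  rcases s with ⟨x, y⟩ | ⟨x, y⟩ <;> rcases t with ⟨x', y'⟩ | ⟨x', y'⟩ <;>
    rcases u with ⟨x'', y''⟩ | ⟨x'', y''⟩ <;> simp only [Rel] at hst htu hus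
  · obtain ⟨rfl, h⟩ := hst
    exact columnRel_no_triangle h3 h htu.2 (hus.1 ▸ hus.2)
  iterate 6 (simp only [ColumnRel, InterceptRel] at *; grind)
  · exact interceptRel_no_triangle h3 hst.2 htu.2 hus.2

/-- Two adjacent points are not opposite to two adjacent lines in a quadrilateral: the differences
used in the columns and in the parallel classes are distinct. -/
theorem not_columnRel_of_interceptRel (h2 : (2 : F) ≠ 0) (h3 : (3 : F) ≠ 0) {x m b b' : F}
    (hp : Kept (.inl (x, m * x + b))) (hp' : Kept (.inl (x, m * x + b')))
    (hl : Kept (.inr (m, b))) (hl' : Kept (.inr (m, b'))) (h : InterceptRel b b') :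
    ¬ ColumnRel x (m * x + b) (m * x + b') := by
  have h4 : (4 : F) ≠ 0 := by
    rw [show (4 : F) = 2 * 2 by norm_num]
    exact mul_ne_zero h2 h2
  simp only [Kept, ColumnRel, InterceptRel] at *
  grind

theorem eq_or_eq_of_incident {x x' y y' m m' b b' : F} (h₁ : y = m * x + b)
    (h₂ : y' = m * x' + b) (h₃ : y = m' * x + b') (h₄ : y' = m' * x' + b') :
    x = x' ∨ m = m' := by
  have h : (x - x') * (m - m') = 0 := by grind
  simpa [sub_eq_zero] using h

theorem rel_no_square (h2 : (2 : F) ≠ 0) (h3 : (3 : F) ≠ 0) {s t u v : F × F ⊕ F × F}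
    (hs : Kept s) (ht : Kept t) (hu : Kept u) (hv : Kept v)
    (hst : Rel s t) (htu : Rel t u) (huv : Rel u v) (hvs : Rel v s) : s = u ∨ t = v := by
  rcases s with ⟨x₁, y₁⟩ | ⟨x₁, y₁⟩ <;> rcases t with ⟨x₂, y₂⟩ | ⟨x₂, y₂⟩ <;>
    rcases u with ⟨x₃, y₃⟩ | ⟨x₃, y₃⟩ <;> rcases v with ⟨x₄, y₄⟩ | ⟨x₄, y₄⟩ <;>
    simp only [Rel] at hst htu huv hvs
  · obtain ⟨rfl, h⟩ := hst
    obtain ⟨rfl, h'⟩ := htu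
    rcases columnRel_no_square h2 h h' huv.2 (hvs.1 ▸ hvs.2) with h | h <;> grind
  · grind [ColumnRel]
  · grind [ColumnRel]
  · obtain ⟨rfl, h⟩ := hst
    obtain ⟨rfl, h'⟩ := huv
    subst htu hvs
    exact absurd (columnRel_symm h) (not_columnRel_of_interceptRel h2 h3 ht hs hu hv h')
  · grind [ColumnRel]
  · rcases eq_or_eq_of_incident hst htu hvs huv with h | h <;> grind
  · obtain ⟨rfl, h⟩ := htu
    obtain ⟨rfl, h'⟩ := hvs
    subst hst huv
    exact absurd (columnRel_symm h') (not_columnRel_of_interceptRel h2 h3 hs hv ht hu h)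
  · grind [InterceptRel]
  · grind [ColumnRel]
  · obtain ⟨rfl, h⟩ := htu
    obtain ⟨rfl, h'⟩ := hvs
    subst hst huv
    exact absurd h (not_columnRel_of_interceptRel h2 h3 ht hu hs hv (interceptRel_symm h'))
  · rcases eq_or_eq_of_incident hst hvs htu huv with h | h <;> grind
  · grind [InterceptRel]
  · obtain ⟨rfl, h⟩ := hst
    obtain ⟨rfl, h'⟩ := huv
    subst htu hvs
    exact absurd h' (not_columnRel_of_interceptRel h2 h3 hu hv ht hs (interceptRel_symm h))
  · grind [InterceptRel]
  · grind [InterceptRel]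
  · obtain ⟨rfl, h⟩ := hst
    obtain ⟨rfl, h'⟩ := htu
    rcases interceptRel_no_square h3 h h' huv.2 hvs.2 with h | h <;> grind

theorem ncard_neighborSet (h3 : (3 : F) ≠ 0) (s : {s : F × F ⊕ F × F // Kept s}) :
    ndeg (graph h3) s = {t | Kept t ∧ Rel s.1 t}.ncard := by
  rw [ndeg, ← Set.ncard_image_of_injective _ Subtype.val_injective]
  congr 1
  ext t
  simp [graph, and_comm]

theorem ndeg_point [Finite F] (h3 : (3 : F) ≠ 0) {x y : F} (h : Kept (.inl (x, y))) :
    ndeg (graph h3) ⟨.inl (x, y), h⟩ =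
      {m | y - m * x ≠ 2}.ncard + {y' | (x = 0 → y' ≠ 2 ∧ y' ≠ 3) ∧ ColumnRel x y y'}.ncard := by
  have hinj : Function.Injective fun m : F => (Sum.inr (m, y - m * x) : F × F ⊕ F × F) :=
    fun m m' hm => by simpa using congrArg (Sum.elim Prod.fst Prod.fst) hm
  have hinj' : Function.Injective fun y' : F => (Sum.inl (x, y') : F × F ⊕ F × F) :=
    fun y₁ y₂ hy => by simpa using hy
  rw [ncard_neighborSet, ← Set.ncard_image_of_injective {y' | _ ∧ _} hinj',
    ← Set.ncard_image_of_injective {m | _ ≠ _} hinj, ← Set.ncard_union_eq]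
  · congr 1
    ext (⟨x', y'⟩ | ⟨m, b⟩)
    · simp [Kept, Rel]
      grind
    · simp [Kept, Rel]
      grind
  · rw [Set.disjoint_left]
    rintro _ ⟨m, -, rfl⟩ ⟨y', -, h⟩
    simp at h

theorem ndeg_line [Finite F] (h3 : (3 : F) ≠ 0) {m b : F} (h : Kept (.inr (m, b))) :
    ndeg (graph h3) ⟨.inr (m, b), h⟩ =
      {x : F | x = 0 → b ≠ 2 ∧ b ≠ 3}.ncard + {b' | b' ≠ 2 ∧ InterceptRel b b'}.ncard := by
  have hinj : Function.Injective fun x : F => (Sum.inl (x, m * x + b) : F × F ⊕ F × F) :=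
    fun x x' hx => by simpa using congrArg (Sum.elim Prod.fst Prod.fst) hx
  have hinj' : Function.Injective fun b' : F => (Sum.inr (m, b') : F × F ⊕ F × F) :=
    fun y₁ y₂ hy => by simpa using hy
  rw [ncard_neighborSet, ← Set.ncard_image_of_injective {b' | _ ≠ _ ∧ _} hinj',
    ← Set.ncard_image_of_injective {x : F | x = 0 → b ≠ 2 ∧ b ≠ 3} hinj, ← Set.ncard_union_eq]
  · congr 1
    ext (⟨x', y'⟩ | ⟨m, b⟩)
    · simp [Kept, Rel]
      grind
    · simp [Kept, Rel]
      grind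
  · rw [Set.disjoint_left]
    rintro _ ⟨m, -, rfl⟩ ⟨y', -, h⟩
    simp at h

theorem five_le_egirth_graph (h2 : (2 : F) ≠ 0) (h3 : (3 : F) ≠ 0) : 5 ≤ (graph h3).egirth :=
  five_le_egirth (fun _ _ _ hab hbc => rel_no_triangle h3 hab hbc)
    fun a b c d hab hbc hcd hda => by
      simpa [Subtype.ext_iff] using
        rel_no_square h2 h3 a.2 b.2 c.2 d.2 hab hbc hcd hda

theorem egirth_graph (h2 : (2 : F) ≠ 0) (h3 : (3 : F) ≠ 0) : (graph h3).egirth = 5 := by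
  refine le_antisymm ?_ (five_le_egirth_graph h2 h3)
  let V := {s : F × F ⊕ F × F // Kept s}
  let a : V := ⟨.inl (1, 0), by simp [Kept]⟩
  let b : V := ⟨.inl (1, 1), by simp [Kept]⟩
  let c : V := ⟨.inr (0, 1), by simp [Kept]; grind⟩
  let d : V := ⟨.inl (2, 1), by simp [Kept, h2]⟩
  let e : V := ⟨.inr (1, -1), by simp [Kept]; grind⟩
  have hab : (graph h3).Adj a b := by simp [graph, a, b, Rel, ColumnRel]
  have hbc : (graph h3).Adj b c := by simp [graph, b, c, Rel]
  have hcd : (graph h3).Adj c d := by simp [graph, c, d, Rel]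
  have hde : (graph h3).Adj d e := by simp [graph, d, e, Rel]; grind
  have hea : (graph h3).Adj e a := by simp [graph, e, a, Rel]
  have hac : a ≠ c := fun h => by simpa [a, c] using congrArg Subtype.val h
  have had : a ≠ d := fun h => by simpa [a, d] using congrArg Subtype.val h
  have hbd : b ≠ d := fun h => by
    have : (1 : F) = 2 := by simpa [b, d] using congrArg Subtype.val h
    grind
  have hbe : b ≠ e := fun h => by simpa [b, e] using congrArg Subtype.val h
  have hce : c ≠ e := fun h => by simpa [c, e] using congrArg Subtype.val h
  clear_value a b c d e
  have hw : (Walk.cons hab (.cons hbc (.cons hcd (.cons hde (.cons hea .nil))))).IsCycle := by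
    simp [Walk.cons_isCycle_iff, hab.ne, hbc.ne, hcd.ne, hde.ne, hea.ne, hac, had, hbd, hbe, hce,
      hab.ne', hea.ne', hac.symm, had.symm]
  exact (SimpleGraph.egirth_le_length hw).trans (by simp)

theorem card_kept [Fintype F] :
    Nat.card {s : F × F ⊕ F × F // Kept s} + Fintype.card F + 2 = 2 * Fintype.card F ^ 2 := by
  have hcompl : {s : F × F ⊕ F × F | Kept s}ᶜ =
      {.inl (0, 2), .inl (0, 3)} ∪ Set.range fun m : F => .inr (m, 2) := by
    ext (⟨x, y⟩ | ⟨m, b⟩)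
    · simp [Kept]; grind
    · simp [Kept]; grind
  have hcard : ({s : F × F ⊕ F × F | Kept s}ᶜ).ncard = 2 + Fintype.card F := by
    rw [hcompl, Set.ncard_union_eq, Set.ncard_pair, ← Set.image_univ,
      Set.ncard_image_of_injective, Set.ncard_univ, Nat.card_eq_fintype_card]
    · intro m m' h
      simpa using h
    · simp; grind
    · rw [Set.disjoint_left]
      rintro _ h ⟨m, rfl⟩
      simp at h
  have := Set.ncard_add_ncard_compl {s : F × F ⊕ F × F | Kept s}
  rw [hcard] at this
  simp only [Nat.card_eq_fintype_card, Fintype.card_sum, Fintype.card_prod] at this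
  rw [show Nat.card {s : F × F ⊕ F × F // Kept s} = {s : F × F ⊕ F × F | Kept s}.ncard from rfl]
  linarith

theorem ndeg_point_eq [Fintype F] [DecidableEq F] (h2 : (2 : F) ≠ 0) (h3 : (3 : F) ≠ 0) {x y : F}
    (h : Kept (.inl (x, y))) :
    ndeg (graph h3) ⟨.inl (x, y), h⟩ =
      if x = 0 ∧ y = 0 then 2 * Fintype.card F - 3 else Fintype.card F + 1 := by
  rw [ndeg_point]
  by_cases hx : x = 0
  · subst hx
    have hy := h rfl
    have hlines := ncard_add_card_of_compl (S := {m : F | y - m * 0 ≠ 2}) ∅ (by simpa using hy.1)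
    by_cases hy0 : y = 0
    · subst hy0
      have hcol := ncard_add_card_of_compl
        (S := {y' : F | ((0 : F) = 0 → y' ≠ 2 ∧ y' ≠ 3) ∧ ColumnRel 0 0 y'}) {0, 2, 3}
        (by simp [ColumnRel]; grind)
      have hT : ({0, 2, 3} : Finset F).card = 3 :=
        Finset.card_eq_three.2 ⟨0, 2, 3, by grind, by grind, by grind, rfl⟩
      simp only [and_self, if_true, Finset.card_empty] at *
      omega
    · have hcol : {y' : F | ((0 : F) = 0 → y' ≠ 2 ∧ y' ≠ 3) ∧ ColumnRel 0 y y'} = {0} := by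
        ext
        simp [ColumnRel]
        grind
      rw [hcol, Set.ncard_singleton, if_neg (by simp [hy0])]
      simpa using hlines
  · have hlines := ncard_add_card_of_compl (S := {m : F | y - m * x ≠ 2}) {(y - 2) / x}
      (by intro m; simp [eq_div_iff hx]; grind)
    have hcol : {y' : F | (x = 0 → y' ≠ 2 ∧ y' ≠ 3) ∧ ColumnRel x y y'} = {y + 1, y - 1} := by
      ext
      simp [ColumnRel, hx]
      grind
    rw [hcol, Set.ncard_pair (by grind), if_neg (by simp [hx])]
    simp only [Finset.card_singleton] at hlines
    omega

theorem ndeg_line_eq [Fintype F] [DecidableEq F] (h2 : (2 : F) ≠ 0) (h3 : (3 : F) ≠ 0) {m b : F}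
    (h : Kept (.inr (m, b))) :
    ndeg (graph h3) ⟨.inr (m, b), h⟩ =
      if b = 1 then 2 * Fintype.card F - 3 else Fintype.card F + 1 := by
  have hb2 : b ≠ 2 := h
  rw [ndeg_line]
  by_cases hb : b = 3
  · subst hb
    have hpoints := ncard_add_card_of_compl (S := {x : F | x = 0 → (3 : F) ≠ 2 ∧ (3 : F) ≠ 3}) {0}
      (by simp)
    have hpar : {b' : F | b' ≠ 2 ∧ InterceptRel 3 b'} = {0, 1} := by
      ext
      simp [InterceptRel]
      grind
    have h31 : (3 : F) ≠ 1 := by grind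
    rw [hpar, Set.ncard_pair zero_ne_one, if_neg h31]
    simp only [Finset.card_singleton] at hpoints
    omega
  · have hpoints := ncard_add_card_of_compl (S := {x : F | x = 0 → b ≠ 2 ∧ b ≠ 3}) ∅
      (by simp [hb2, hb])
    simp only [Finset.card_empty] at hpoints
    by_cases hb1 : b = 1
    · subst hb1
      have hpar := ncard_add_card_of_compl (S := {b' : F | b' ≠ 2 ∧ InterceptRel 1 b'}) {0, 1, 2}
        (by simp [InterceptRel]; grind)
      have hT : ({0, 1, 2} : Finset F).card = 3 :=
        Finset.card_eq_three.2 ⟨0, 1, 2, by grind, by grind, by grind, rfl⟩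
      rw [if_pos rfl]
      omega
    · have hpar : ∃ c, {b' : F | b' ≠ 2 ∧ InterceptRel b b'} = {c} := by
        refine ⟨if b = 0 then 3 else 1, ?_⟩
        ext
        simp [InterceptRel]
        grind
      obtain ⟨c, hc⟩ := hpar
      rw [hc, Set.ncard_singleton, if_neg hb1]
      omega

theorem degreeSet_graph [Fintype F] (h2 : (2 : F) ≠ 0) (h3 : (3 : F) ≠ 0) :
    degreeSet' (graph h3) = {Fintype.card F + 1, 2 * Fintype.card F - 3} := by
  classical
  refine Set.Subset.antisymm ?_ ?_
  · rintro _ ⟨⟨⟨x, y⟩ | ⟨m, b⟩, h⟩, rfl⟩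
    · rw [ndeg_point_eq h2]
      split_ifs <;> simp
    · rw [ndeg_line_eq h2]
      split_ifs <;> simp
  · rintro _ (rfl | rfl)
    · have h : Kept (.inr ((0 : F), (0 : F))) := h2.symm
      exact ⟨⟨_, h⟩, by rw [ndeg_line_eq h2, if_neg zero_ne_one]⟩
    · have h : Kept (.inl ((0 : F), (0 : F))) := fun _ => ⟨h2.symm, h3.symm⟩
      exact ⟨⟨_, h⟩, by rw [ndeg_point_eq h2, if_pos ⟨rfl, rfl⟩]⟩

end Biaffine

/-- for every prime q ≡ 1 (mod 4) with q ≥ 13 and r = q+1, the minimum order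
of a graph with degree set {r, 2r−5} and girth 5 is r(2r−5) + 1 = 2q² − q − 2. -/
theorem stmt16 (q r : ℕ) (hq : q.Prime) (hq1 : q % 4 = 1) (hq13 : 13 ≤ q) (hr : r = q + 1) :
    r * (2 * r - 5) + 1 = 2 * q ^ 2 - q - 2 ∧
    IsLeast (cageOrders {r, 2 * r - 5}) (r * (2 * r - 5) + 1) := by
  have : Fact q.Prime := ⟨hq⟩
  have hne : ∀ n : ℕ, 0 < n → n < q → (n : ZMod q) ≠ 0 := fun n h0 hn h =>
    absurd (Nat.le_of_dvd h0 ((ZMod.natCast_eq_zero_iff n q).1 h)) (not_le.2 hn)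
  have h2 : (2 : ZMod q) ≠ 0 := by exact_mod_cast hne 2 (by omega) (by omega)
  have h3 : (3 : ZMod q) ≠ 0 := by exact_mod_cast hne 3 (by omega) (by omega)
  have hm : 2 * r - 5 = 2 * q - 3 := by omega
  have horder : r * (2 * r - 5) + 1 + q + 2 = 2 * q ^ 2 := by
    obtain ⟨k, rfl⟩ : ∃ k, q = k + 2 := ⟨q - 2, by omega⟩
    rw [hm, show 2 * (k + 2) - 3 = 2 * k + 1 by omega, hr]
    ring
  refine ⟨by omega, ?_, ?_⟩
  · refine ⟨_, Biaffine.graph h3, inferInstance, ?_, Biaffine.egirth_graph h2 h3, ?_⟩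
    · have := Biaffine.card_kept (F := ZMod q)
      rw [ZMod.card] at this
      omega
    · rw [Biaffine.degreeSet_graph h2 h3, ZMod.card, hm, hr]
  · rintro n ⟨V, G, hV, rfl, hG, hD⟩
    obtain ⟨v, hv⟩ : 2 * r - 5 ∈ degreeSet' G := by simp [hD]
    rw [← hv]
    refine mul_ndeg_add_one_le_card hG.ge (fun u => ?_) v
    have hu : ndeg G u ∈ ({r, 2 * r - 5} : Set ℕ) := hD ▸ ⟨u, rfl⟩
    rcases hu with hu | hu
    · exact hu.ge
    · rw [hu]
      omega
end
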